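/- Let u be an involution in a finite Weyl group W, let d be the reflection length of u (the minimal number of reflections whose product is u), and suppose u = s_{γ₁}⋯s_{γ_d} for roots γ₁, …, γ_d ∈ Δ. Then the roots γ₁, …, γ_d are pairwise orthogonal. -/

import Mathlib

set_option linter.unusedSectionVars false

open scoped RealInnerProductSpace
open Module

variable {V : Type*} [NormedAddCommGroup V] [InnerProductSpace ℝ V] [FiniteDimensional ℝ V]

/-- The reflection in the hyperplane orthogonal to `γ` (the identity if `γ = 0`). -/
noncomputable def srefl (γ : V) : V →ₗ[ℝ] V :=
  LinearMap.id - (LinearMap.toSpanSingleton ℝ V ((2 / ⟪γ, γ⟫) • γ)).comp (innerSL ℝ γ).toLinearMap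

lemma srefl_apply (γ x : V) : srefl γ x = x - (2 * ⟪γ, x⟫ / ⟪γ, γ⟫) • γ := by
  simp [srefl, LinearMap.toSpanSingleton, smul_smul]
  ring_nf

lemma srefl_involutive (γ : V) : Function.Involutive (srefl γ) := by
  intro x
  rcases eq_or_ne γ 0 with h | h
  · simp [srefl_apply, h]
  · have hγ : ⟪γ, γ⟫ ≠ 0 := fun hc => h (inner_self_eq_zero.mp hc)
    rw [srefl_apply, srefl_apply, inner_sub_right, real_inner_smul_right]
    field_simp
    ring_nf
    module

/-- The reflection in `γ` as a linear automorphism of `V`. -/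
noncomputable def sref (γ : V) : V ≃ₗ[ℝ] V :=
  { srefl γ with
    invFun := srefl γ
    left_inv := srefl_involutive γ
    right_inv := srefl_involutive γ }

/-- A finite reduced crystallographic root system spanning `V`. -/
structure IsRootSystem (Δ : Set V) : Prop where
  finite : Δ.Finite
  nonzero : (0 : V) ∉ Δ
  span_top : Submodule.span ℝ Δ = ⊤
  refl_mem : ∀ γ ∈ Δ, ∀ β ∈ Δ, sref γ β ∈ Δ
  crystallographic : ∀ γ ∈ Δ, ∀ β ∈ Δ, ∃ m : ℤ, 2 * ⟪β, γ⟫ / ⟪γ, γ⟫ = (m : ℝ)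
  reduced : ∀ γ ∈ Δ, ∀ t : ℝ, t • γ ∈ Δ → t = 1 ∨ t = -1

/-- The Weyl group: the subgroup of `GL(V)` generated by the reflections in the roots. -/
def weylGroup (Δ : Set V) : Subgroup (V ≃ₗ[ℝ] V) :=
  Subgroup.closure {g | ∃ γ ∈ Δ, g = sref γ}

/-- The reflection length of `w`: the least number of reflections in roots whose
product is `w`. -/
noncomputable def reflLength (Δ : Set V) (w : V ≃ₗ[ℝ] V) : ℕ :=
  sInf {r | ∃ γ : Fin r → V, (∀ i, γ i ∈ Δ) ∧ w = (List.ofFn fun i => sref (γ i)).prod}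

/-- A base (system of simple roots `α` with positive roots `Pos`) for the root system `Δ`. -/
structure IsBase (Δ Pos : Set V) {n : ℕ} (α : Fin n → V) : Prop where
  pos_subset : Pos ⊆ Δ
  simple_mem : ∀ i, α i ∈ Pos
  mem_or_neg : ∀ γ ∈ Δ, γ ∈ Pos ∨ -γ ∈ Pos
  not_neg : ∀ γ ∈ Pos, -γ ∉ Pos
  pos_combo : ∀ γ ∈ Pos, ∃ c : Fin n → ℕ, γ = ∑ j, (c j : ℝ) • α j

/-- `l` is a word (in the simple reflections) for `w`. -/
def IsWord {n : ℕ} (α : Fin n → V) (l : List (Fin n)) (w : V ≃ₗ[ℝ] V) : Prop :=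
  (l.map fun j => sref (α j)).prod = w

/-- The Coxeter length of `w` with respect to the simple system `α`. -/
noncomputable def len {n : ℕ} (α : Fin n → V) (w : V ≃ₗ[ℝ] V) : ℕ :=
  sInf {r | ∃ l : List (Fin n), IsWord α l w ∧ l.length = r}

/-- Bruhat order: `v ≤ w` iff some reduced word for `w` has a subword with value `v`. -/
def bruhatLE {n : ℕ} (α : Fin n → V) (v w : V ≃ₗ[ℝ] V) : Prop :=
  ∃ l : List (Fin n), IsWord α l w ∧ l.length = len α w ∧
    ∃ l' : List (Fin n), l'.Sublist l ∧ IsWord α l' v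

/-- The product of the simple reflections indexed by a word given as a function
`i : Fin m → Fin n`, along a list of positions. -/
noncomputable def fwordProd {n m : ℕ} (α : Fin n → V) (i : Fin m → Fin n)
    (l : List (Fin m)) : V ≃ₗ[ℝ] V :=
  (l.map fun j => sref (α (i j))).prod

/-- The full product `s_{i₁} ⋯ s_{i_m}`. -/
noncomputable def fullProd {n m : ℕ} (α : Fin n → V) (i : Fin m → Fin n) : V ≃ₗ[ℝ] V :=
  fwordProd α i (List.finRange m)

/-- The root `β_k = s_{i₁} ⋯ s_{i_{k-1}} (α_{i_k})` associated to the `k`-th position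
of the word `i` (positions indexed from `0`). -/
noncomputable def betaRoot {n m : ℕ} (α : Fin n → V) (i : Fin m → Fin n) (k : Fin m) : V :=
  fwordProd α i ((List.finRange m).take k) (α (i k))

/-- The value of the subword of `i` obtained by deleting the positions `p t`. -/
noncomputable def complProd {n m d : ℕ} (α : Fin n → V) (i : Fin m → Fin n)
    (p : Fin d → Fin m) : V ≃ₗ[ℝ] V :=
  fwordProd α i ((List.finRange m).filter fun j => ∀ t, p t ≠ j)

lemma sref_apply (γ x : V) : sref γ x = x - (2 * ⟪γ, x⟫ / ⟪γ, γ⟫) • γ := srefl_apply γ x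

lemma sref_sref (γ x : V) : sref γ (sref γ x) = x := srefl_involutive γ x

lemma sref_mul_self (γ : V) : sref γ * sref γ = 1 :=
  LinearEquiv.ext fun x => sref_sref γ x

lemma sref_self (γ : V) : sref γ γ = -γ := by
  rcases eq_or_ne γ 0 with h | h
  · simp [h]
  · have hγ : ⟪γ, γ⟫ ≠ 0 := fun hc => h (inner_self_eq_zero.mp hc)
    rw [sref_apply, mul_div_assoc, div_self hγ]
    module

lemma sref_of_inner_eq_zero {γ x : V} (h : ⟪γ, x⟫ = 0) : sref γ x = x := by
  simp [sref_apply, h]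

lemma inner_sref_sref (γ x y : V) : ⟪sref γ x, sref γ y⟫ = ⟪x, y⟫ := by
  rcases eq_or_ne γ 0 with h | h
  · simp [sref_apply, h]
  · have hγ : ⟪γ, γ⟫ ≠ 0 := fun hc => h (inner_self_eq_zero.mp hc)
    simp only [sref_apply, inner_sub_left, inner_sub_right, real_inner_smul_left,
      real_inner_smul_right, real_inner_comm γ x]
    field_simp
    ring

/-- An isometry conjugates the reflection in `γ` to the reflection in the image of `γ`. -/
lemma mul_sref_of_isometry {g : V ≃ₗ[ℝ] V} (hg : ∀ x y, ⟪g x, g y⟫ = ⟪x, y⟫) (γ : V) :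
    g * sref γ = sref (g γ) * g := by
  ext x
  simp only [LinearEquiv.mul_apply, sref_apply, map_sub, map_smul, hg]

lemma inner_apply_of_mem_weylGroup {Δ : Set V} {w : V ≃ₗ[ℝ] V} (hw : w ∈ weylGroup Δ) :
    ∀ x y, ⟪w x, w y⟫ = ⟪x, y⟫ := by
  induction hw using Subgroup.closure_induction with
  | mem g hg =>
    obtain ⟨γ, -, rfl⟩ := hg
    exact inner_sref_sref γ
  | one => intro x y; rfl
  | mul g h _ _ hg hh => intro x y; rw [LinearEquiv.mul_apply, LinearEquiv.mul_apply, hg, hh]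
  | inv g _ hg =>
    intro x y
    rw [← hg, ← LinearEquiv.mul_apply, ← LinearEquiv.mul_apply, mul_inv_cancel]
    rfl

lemma sref_mem_weylGroup {Δ : Set V} {γ : V} (h : γ ∈ Δ) : sref γ ∈ weylGroup Δ :=
  Subgroup.subset_closure ⟨γ, h, rfl⟩

lemma list_prod_mem_weylGroup {Δ : Set V} {l : List V} (hl : ∀ a ∈ l, a ∈ Δ) :
    (l.map sref).prod ∈ weylGroup Δ := by
  apply Subgroup.list_prod_mem
  intro g hg
  obtain ⟨a, ha, rfl⟩ := List.mem_map.mp hg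
  exact sref_mem_weylGroup (hl a ha)

lemma exists_list_of_mem_weylGroup {Δ : Set V} {w : V ≃ₗ[ℝ] V} (hw : w ∈ weylGroup Δ) :
    ∃ l : List V, (∀ a ∈ l, a ∈ Δ) ∧ (l.map sref).prod = w := by
  induction hw using Subgroup.closure_induction with
  | mem g hg =>
    obtain ⟨γ, h, rfl⟩ := hg
    exact ⟨[γ], by simpa using h, by simp⟩
  | one => exact ⟨[], by simp, by simp⟩
  | mul g h _ _ hg hh =>
    obtain ⟨l, hl, rfl⟩ := hg
    obtain ⟨m, hm, rfl⟩ := hh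
    refine ⟨l ++ m, ?_, by simp⟩
    intro a ha
    rcases List.mem_append.mp ha with h | h
    exacts [hl a h, hm a h]
  | inv g _ hg =>
    obtain ⟨l, hl, rfl⟩ := hg
    refine ⟨l.reverse, by simpa using hl, ?_⟩
    have hinv : (fun g => g⁻¹) ∘ sref = (sref : V → V ≃ₗ[ℝ] V) := by
      funext a
      exact inv_eq_of_mul_eq_one_left (sref_mul_self a)
    rw [List.prod_inv_reverse, List.map_map, hinv, List.map_reverse]

namespace IsRootSystem

variable {Δ : Set V}

lemma ne_zero (hΔ : IsRootSystem Δ) {γ : V} (h : γ ∈ Δ) : γ ≠ 0 :=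
  fun hc => hΔ.nonzero (hc ▸ h)

lemma neg_mem (hΔ : IsRootSystem Δ) {γ : V} (h : γ ∈ Δ) : -γ ∈ Δ :=
  sref_self γ ▸ hΔ.refl_mem γ h γ h

lemma weylGroup_apply_mem (hΔ : IsRootSystem Δ) {w : V ≃ₗ[ℝ] V} (hw : w ∈ weylGroup Δ)
    {β : V} (hβ : β ∈ Δ) : w β ∈ Δ := by
  obtain ⟨l, hl, rfl⟩ := exists_list_of_mem_weylGroup hw
  clear hw
  induction l with
  | nil => simpa using hβ
  | cons a t ih =>
    rw [List.map_cons, List.prod_cons, LinearEquiv.mul_apply]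
    exact hΔ.refl_mem a (hl a (by simp)) _ (ih fun b hb => hl b (by simp [hb]))

end IsRootSystem

/-- The roots that are positive on `x`. -/
def positiveRoots (Δ : Set V) (x : V) : Set V := {β | β ∈ Δ ∧ 0 < ⟪β, x⟫}

/-- The positive roots whose reflection permutes the other positive roots. -/
def simpleRoots (Δ : Set V) (x : V) : Set V :=
  {α | α ∈ positiveRoots Δ x ∧
    ∀ β ∈ positiveRoots Δ x, β ≠ α → sref α β ∈ positiveRoots Δ x}

lemma neg_notMem_positiveRoots {Δ : Set V} {x β : V} (h : β ∈ positiveRoots Δ x) :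
    -β ∉ positiveRoots Δ x := by
  intro hc
  have h1 := h.2
  have h2 := hc.2
  rw [inner_neg_left] at h2
  linarith

lemma mem_or_neg_mem_positiveRoots {Δ : Set V} (hΔ : IsRootSystem Δ) {x : V}
    (hx : ∀ β ∈ Δ, ⟪β, x⟫ ≠ 0) {β : V} (h : β ∈ Δ) :
    β ∈ positiveRoots Δ x ∨ -β ∈ positiveRoots Δ x := by
  rcases lt_or_gt_of_ne (hx β h) with h' | h'
  · exact Or.inr ⟨hΔ.neg_mem h, by rw [inner_neg_left]; linarith⟩
  · exact Or.inl ⟨h, h'⟩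

/-- A vector of `F` avoiding finitely many hyperplanes, none of which contains `F`. -/
lemma exists_mem_forall_inner_ne_zero (F : Submodule ℝ V) {T : Set V} (hT : T.Finite)
    (h : ∀ v ∈ T, ∃ y ∈ F, ⟪v, y⟫ ≠ 0) : ∃ x ∈ F, ∀ v ∈ T, ⟪v, x⟫ ≠ 0 := by
  induction T, hT using Set.Finite.induction_on with
  | empty => exact ⟨0, F.zero_mem, by simp⟩
  | @insert a S _ hS ih =>
    obtain ⟨x, hxF, hx⟩ := ih fun v hv => h v (Set.mem_insert_of_mem _ hv)
    obtain ⟨y, hyF, hy⟩ := h a (Set.mem_insert _ _)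
    have key : ∀ v ∈ insert a S, Set.Finite {t : ℝ | ⟪v, y + t • x⟫ = 0} := by
      intro v hv
      have hne : ⟪v, y⟫ ≠ 0 ∨ ⟪v, x⟫ ≠ 0 := by
        rcases hv with rfl | hv
        exacts [Or.inl hy, Or.inr (hx v hv)]
      apply Set.Subsingleton.finite
      intro s hs t ht
      simp only [Set.mem_ofPred_eq, inner_add_right, real_inner_smul_right] at hs ht
      by_cases h0 : ⟪v, x⟫ = 0
      · simp [h0] at hs hne
        exact absurd hs hne
      · apply mul_right_cancel₀ h0
        linarith
    have hfin := (hS.insert a).biUnion key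
    obtain ⟨t, ht⟩ := hfin.exists_notMem
    refine ⟨y + t • x, F.add_mem hyF (F.smul_mem t hxF), fun v hv hc => ht ?_⟩
    exact Set.mem_biUnion hv hc

/-- A regular vector can be perturbed off finitely many hyperplanes without changing which
elements of a finite set are positive on it. -/
lemma exists_forall_inner_ne_zero_of_perturb {A T : Set V} (hA : A.Finite) (hT : T.Finite)
    (hT0 : (0 : V) ∉ T) (x : V) :
    ∃ x' : V, (∀ β ∈ A, 0 < ⟪β, x⟫ → 0 < ⟪β, x'⟫) ∧ ∀ v ∈ T, ⟪v, x'⟫ ≠ 0 := by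
  obtain ⟨z, -, hz⟩ := exists_mem_forall_inner_ne_zero ⊤ hT fun v hv =>
    ⟨v, trivial, fun hc => hT0 (inner_self_eq_zero.mp hc ▸ hv)⟩
  have h1 : ∀ β ∈ A, ∀ᶠ ε : ℝ in nhdsWithin 0 (Set.Ioi 0),
      0 < ⟪β, x⟫ → 0 < ⟪β, x + ε • z⟫ := by
    intro β _
    by_cases hβ : 0 < ⟪β, x⟫
    · have hc : Continuous fun ε : ℝ => ⟪β, x + ε • z⟫ := by fun_prop
      have : ∀ᶠ ε : ℝ in nhds 0, 0 < ⟪β, x + ε • z⟫ :=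
        hc.continuousAt.eventually_const_lt (by simpa using hβ)
      exact (this.filter_mono nhdsWithin_le_nhds).mono fun _ h _ => h
    · exact Filter.Eventually.of_forall fun _ h => absurd h hβ
  have h2 : ∀ᶠ ε : ℝ in nhdsWithin 0 (Set.Ioi 0), ∀ v ∈ T, ⟪v, x + ε • z⟫ ≠ 0 := by
    rw [Filter.eventually_all_finite hT]
    intro v hv
    have hfin : Set.Finite {ε : ℝ | ⟪v, x + ε • z⟫ = 0} := by
      apply Set.Subsingleton.finite
      intro s hs t ht
      simp only [Set.mem_ofPred_eq, inner_add_right, real_inner_smul_right] at hs ht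
      apply mul_right_cancel₀ (hz v hv)
      linarith
    by_cases h0 : ⟪v, x⟫ = 0
    · filter_upwards [self_mem_nhdsWithin] with ε hε
      have : ε ≠ 0 := ne_of_gt hε
      simp [inner_add_right, real_inner_smul_right, h0, this, hz v hv]
    · have : {ε : ℝ | ⟪v, x + ε • z⟫ = 0}ᶜ ∈ nhds (0 : ℝ) :=
        hfin.isClosed.isOpen_compl.mem_nhds (by simpa using h0)
      exact nhdsWithin_le_nhds this
  obtain ⟨ε, hε⟩ := (((Filter.eventually_all_finite hA).mpr h1).and h2).exists
  exact ⟨x + ε • z, hε⟩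

/-- `x` pairs nontrivially with every root, and a ray from `x` in the direction of a root never
crosses two root hyperplanes at once. -/
structure IsGeneric (Δ : Set V) (x : V) : Prop where
  inner_ne_zero : ∀ β ∈ Δ, ⟪β, x⟫ ≠ 0
  eq_of_inner_eq_zero : ∀ γ ∈ Δ, ∀ α ∈ Δ, ∀ β ∈ Δ,
    ⟪⟪γ, α⟫ • β - ⟪γ, β⟫ • α, x⟫ = 0 → ⟪γ, α⟫ • β - ⟪γ, β⟫ • α = 0

lemma exists_isGeneric_positiveRoots_eq {Δ : Set V} (hΔ : IsRootSystem Δ) {x : V}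
    (hx : ∀ β ∈ Δ, ⟪β, x⟫ ≠ 0) :
    ∃ x', IsGeneric Δ x' ∧ positiveRoots Δ x' = positiveRoots Δ x := by
  let T : Set V := (fun p : V × V × V => ⟪p.1, p.2.1⟫ • p.2.2 - ⟪p.1, p.2.2⟫ • p.2.1) ''
    (Δ ×ˢ Δ ×ˢ Δ)
  have hT : T.Finite := (hΔ.finite.prod (hΔ.finite.prod hΔ.finite)).image _
  obtain ⟨x', hpos, hne⟩ := exists_forall_inner_ne_zero_of_perturb hΔ.finite
    (hT.sdiff (t := {0})) (by simp) x
  have hlt : ∀ β ∈ Δ, 0 < ⟪β, x'⟫ → 0 < ⟪β, x⟫ := by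
    intro β hβ h
    by_contra hc
    have h2 := hpos (-β) (hΔ.neg_mem hβ) (by
      rw [inner_neg_left]
      have := lt_of_le_of_ne (not_lt.mp hc) (hx β hβ)
      linarith)
    rw [inner_neg_left] at h2
    linarith
  refine ⟨x', ⟨fun β hβ => ?_, fun γ hγ α hα β hβ h => ?_⟩, ?_⟩
  · rcases mem_or_neg_mem_positiveRoots hΔ hx hβ with h | h
    · exact ne_of_gt (hpos β hβ h.2)
    · have := hpos _ h.1 h.2
      rw [inner_neg_left] at this
      linarith
  · by_contra h0
    exact hne _ ⟨⟨(γ, α, β), ⟨hγ, hα, hβ⟩, rfl⟩, h0⟩ h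
  · ext β
    exact ⟨fun h => ⟨h.1, hlt β h.1 h.2⟩, fun h => ⟨h.1, hpos β h.1 h.2⟩⟩

/-- A positive root pairs positively with some simple root. -/
lemma exists_simpleRoot_inner_pos {Δ : Set V} (hΔ : IsRootSystem Δ) {x : V}
    (hx : IsGeneric Δ x) {γ : V} (hγ : γ ∈ positiveRoots Δ x) :
    ∃ α ∈ simpleRoots Δ x, 0 < ⟪γ, α⟫ := by
  let B : Set V := {β | β ∈ positiveRoots Δ x ∧ 0 < ⟪γ, β⟫}
  have hBfin : B.Finite := hΔ.finite.subset fun β h => h.1.1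
  have hBne : B.Nonempty := ⟨γ, hγ, real_inner_self_pos.mpr (hΔ.ne_zero hγ.1)⟩
  obtain ⟨α, ⟨hα, hγα⟩, hmin⟩ := Set.exists_min_image B (fun β => ⟪β, x⟫ / ⟪γ, β⟫) hBfin hBne
  obtain ⟨t, ht⟩ : ∃ t, t = ⟪α, x⟫ / ⟪γ, α⟫ := ⟨_, rfl⟩
  have htpos : 0 < t := ht ▸ div_pos hα.2 hγα
  obtain ⟨p, hp⟩ : ∃ p, p = x - t • γ := ⟨_, rfl⟩
  have hip : ∀ β, ⟪β, p⟫ = ⟪β, x⟫ - t * ⟪γ, β⟫ := by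
    intro β
    rw [hp, inner_sub_right, real_inner_smul_right, real_inner_comm β γ]
  have hαp : ⟪α, p⟫ = 0 := by
    rw [hip, ht]
    field_simp
    ring
  have hβp : ∀ β ∈ positiveRoots Δ x, β ≠ α → 0 < ⟪β, p⟫ := by
    intro β hβ hne
    rw [hip]
    rcases le_or_gt ⟪γ, β⟫ 0 with h | h
    · nlinarith [hβ.2]
    · have h1 := hmin β ⟨hβ, h⟩
      simp only [← ht] at h1
      rw [le_div_iff₀ h] at h1
      refine lt_of_le_of_ne (by linarith) fun hc => hne ?_
      have h2 := hx.eq_of_inner_eq_zero γ hγ.1 α hα.1 β hβ.1 (by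
        have : t * ⟪γ, α⟫ = ⟪α, x⟫ := by rw [ht]; field_simp
        rw [inner_sub_left, real_inner_smul_left, real_inner_smul_left, ← this]
        have : ⟪β, x⟫ = t * ⟪γ, β⟫ := by linarith
        rw [this]
        ring)
      have h3 : β = (⟪γ, β⟫ / ⟪γ, α⟫) • α := by
        rw [div_eq_inv_mul, mul_smul, ← sub_eq_zero.mp h2, smul_smul,
          inv_mul_cancel₀ hγα.ne', one_smul]
      rcases hΔ.reduced α hα.1 _ (h3 ▸ hβ.1) with h4 | h4
      · rw [h3, h4, one_smul]
      · have := div_pos h hγα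
        linarith
  refine ⟨α, ⟨hα, fun β hβ hne => ?_⟩, hγα⟩
  have h1 : ⟪sref α β, p⟫ = ⟪β, p⟫ := by
    rw [sref_apply, inner_sub_left, real_inner_smul_left, hαp]
    ring
  rcases mem_or_neg_mem_positiveRoots hΔ hx.inner_ne_zero (hΔ.refl_mem α hα.1 β hβ.1) with h | h
  · exact h
  · exfalso
    have h2 := hβp β hβ hne
    have h3 : 0 ≤ ⟪-sref α β, p⟫ := by
      by_cases he : -sref α β = α
      · rw [he, hαp]
      · exact (hβp _ h he).le
    rw [inner_neg_left, h1] at h3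
    linarith

lemma sref_mem_weylGroup_simpleRoots {Δ : Set V} (hΔ : IsRootSystem Δ) {x : V}
    (hx : IsGeneric Δ x) {γ : V} (hγ : γ ∈ positiveRoots Δ x) :
    sref γ ∈ weylGroup (simpleRoots Δ x) := by
  by_contra hc
  let B : Set V := {β | β ∈ positiveRoots Δ x ∧ sref β ∉ weylGroup (simpleRoots Δ x)}
  have hBfin : B.Finite := hΔ.finite.subset fun β h => h.1.1
  obtain ⟨β, ⟨hβ, hβn⟩, hmin⟩ := Set.exists_min_image B (fun β => ⟪β, x⟫) hBfin ⟨γ, hγ, hc⟩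
  obtain ⟨α, hα, hβα⟩ := exists_simpleRoot_inner_pos hΔ hx hβ
  have hsα := sref_mem_weylGroup hα
  rcases eq_or_ne β α with rfl | hne
  · exact hβn hsα
  have hmem := hα.2 β hβ hne
  have hlow : sref (sref α β) ∈ weylGroup (simpleRoots Δ x) := by
    by_contra h
    have h1 := hmin _ ⟨hmem, h⟩
    simp only [sref_apply, inner_sub_left, real_inner_smul_left] at h1
    have h2 : 0 < 2 * ⟪α, β⟫ / ⟪α, α⟫ * ⟪α, x⟫ := by
      rw [real_inner_comm]
      have := real_inner_self_pos.mpr (hΔ.ne_zero hα.1.1)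
      have := hα.1.2
      positivity
    linarith
  apply hβn
  have h1 := mul_sref_of_isometry (inner_sref_sref α) β
  have h2 : sref β = sref α * (sref (sref α β) * sref α) := by
    rw [← h1, ← mul_assoc, sref_mul_self, one_mul]
  rw [h2]
  exact mul_mem hsα (mul_mem hlow hsα)

lemma sref_neg (γ : V) : sref (-γ) = sref γ := by
  ext x
  rw [sref_apply, sref_apply, inner_neg_left, inner_neg_neg, mul_neg, neg_div, neg_smul_neg]

lemma weylGroup_le_weylGroup_simpleRoots {Δ : Set V} (hΔ : IsRootSystem Δ) {x : V}
    (hx : IsGeneric Δ x) : weylGroup Δ ≤ weylGroup (simpleRoots Δ x) := by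
  refine (Subgroup.closure_le _).mpr ?_
  rintro _ ⟨γ, hγ, rfl⟩
  rcases mem_or_neg_mem_positiveRoots hΔ hx.inner_ne_zero hγ with h | h
  · exact sref_mem_weylGroup_simpleRoots hΔ hx h
  · exact sref_neg γ ▸ sref_mem_weylGroup_simpleRoots hΔ hx h

/-- The exchange condition for words in the simple reflections. -/
lemma exists_shorter_of_neg_mem {Δ : Set V} (hΔ : IsRootSystem Δ) {x : V}
    (hx : ∀ β ∈ Δ, ⟪β, x⟫ ≠ 0) {α : V} (hα : α ∈ positiveRoots Δ x) (l : List V)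
    (hl : ∀ a ∈ l, a ∈ simpleRoots Δ x) (hneg : -(l.map sref).prod α ∈ positiveRoots Δ x) :
    ∃ l' : List V, (∀ a ∈ l', a ∈ simpleRoots Δ x) ∧ l'.length < l.length ∧
      (l'.map sref).prod = (l.map sref).prod * sref α := by
  induction l with
  | nil => exact absurd (by simpa using hneg) (neg_notMem_positiveRoots hα)
  | cons a t ih =>
    have ht : ∀ b ∈ t, b ∈ simpleRoots Δ x := fun b hb => hl b (by simp [hb])
    have ha := hl a (by simp)
    have htW : (t.map sref).prod ∈ weylGroup Δ :=
      list_prod_mem_weylGroup fun b hb => (ht b hb).1.1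
    rcases mem_or_neg_mem_positiveRoots hΔ hx (hΔ.weylGroup_apply_mem htW hα.1) with h | h
    · have heq : (t.map sref).prod α = a := by
        by_contra hne
        refine neg_notMem_positiveRoots (ha.2 _ h hne) ?_
        simpa using hneg
      refine ⟨t, ht, by simp, ?_⟩
      rw [List.map_cons, List.prod_cons, mul_assoc,
        mul_sref_of_isometry (inner_apply_of_mem_weylGroup htW), heq, ← mul_assoc,
        sref_mul_self, one_mul]
    · obtain ⟨t', ht', hlen, hprod⟩ := ih ht h
      refine ⟨a :: t', ?_, by simpa using hlen, by simp [hprod, mul_assoc]⟩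
      intro b hb
      rcases List.mem_cons.mp hb with rfl | hb
      exacts [ha, ht' b hb]

lemma list_prod_eq_one_of_maps_positiveRoots {Δ : Set V} (hΔ : IsRootSystem Δ) {x : V}
    (hx : ∀ β ∈ Δ, ⟪β, x⟫ ≠ 0) (n : ℕ) : ∀ l : List V, l.length = n →
    (∀ a ∈ l, a ∈ simpleRoots Δ x) →
    (∀ β ∈ positiveRoots Δ x, (l.map sref).prod β ∈ positiveRoots Δ x) →
    (l.map sref).prod = 1 := by
  induction n using Nat.strong_induction_on with
  | _ n ih =>
    intro l hn hl hpos
    rcases List.eq_nil_or_concat l with rfl | ⟨t, α, rfl⟩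
    · simp
    have hα : α ∈ simpleRoots Δ x := hl α (by simp)
    have hprod : ((t ++ [α]).map sref).prod = (t.map sref).prod * sref α := by simp
    simp only [List.concat_eq_append] at hn hl hpos ⊢
    rw [hprod] at hpos ⊢
    have h1 := hpos α hα.1
    rw [LinearEquiv.mul_apply, sref_self, map_neg] at h1
    obtain ⟨l', hl', hlen, heq⟩ := exists_shorter_of_neg_mem hΔ hx hα.1 t
      (fun a ha => hl a (by simp [ha])) h1
    rw [← heq] at hpos ⊢
    refine ih l'.length ?_ l' rfl hl' hpos
    rw [← hn, List.length_append]
    omega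

/-- The Weyl group acts freely on regular vectors. -/
lemma eq_one_of_apply_eq_self {Δ : Set V} (hΔ : IsRootSystem Δ) {x : V}
    (hx : ∀ β ∈ Δ, ⟪β, x⟫ ≠ 0) {w : V ≃ₗ[ℝ] V} (hw : w ∈ weylGroup Δ) (hwx : w x = x) :
    w = 1 := by
  obtain ⟨x', hgen, hpos⟩ := exists_isGeneric_positiveRoots_eq hΔ hx
  obtain ⟨l, hl, rfl⟩ :=
    exists_list_of_mem_weylGroup (weylGroup_le_weylGroup_simpleRoots hΔ hgen hw)
  refine list_prod_eq_one_of_maps_positiveRoots hΔ hgen.inner_ne_zero _ l rfl hl ?_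
  rw [hpos]
  intro β hβ
  refine ⟨hΔ.weylGroup_apply_mem hw hβ.1, ?_⟩
  have := inner_apply_of_mem_weylGroup hw β x
  rw [hwx] at this
  exact this ▸ hβ.2

/-- The vectors fixed by `w`. -/
def fixedSpace (w : V ≃ₗ[ℝ] V) : Submodule ℝ V := LinearMap.ker (w.toLinearMap - LinearMap.id)

lemma mem_fixedSpace {w : V ≃ₗ[ℝ] V} {x : V} : x ∈ fixedSpace w ↔ w x = x := by
  simp [fixedSpace, sub_eq_zero]

/-- A nontrivial Weyl group element moves some vector by a root orthogonal to its fixed space. -/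
lemma exists_root_eq_apply_sub {Δ : Set V} (hΔ : IsRootSystem Δ) {w : V ≃ₗ[ℝ] V}
    (hw : w ∈ weylGroup Δ) (hne : w ≠ 1) :
    ∃ α ∈ Δ, (∀ y ∈ fixedSpace w, ⟪α, y⟫ = 0) ∧ ∃ y, w y - y = α := by
  have hex : ∃ α ∈ Δ, ∀ y ∈ fixedSpace w, ⟪α, y⟫ = 0 := by
    by_contra! hc
    obtain ⟨x, hxF, hx⟩ := exists_mem_forall_inner_ne_zero (fixedSpace w) hΔ.finite hc
    exact hne (eq_one_of_apply_eq_self hΔ hx hw (mem_fixedSpace.mp hxF))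
  obtain ⟨α, hα, horth⟩ := hex
  refine ⟨α, hα, horth, ?_⟩
  have hiso := inner_apply_of_mem_weylGroup hw
  let R := LinearMap.range (w.toLinearMap - LinearMap.id)
  have hR : α ∈ Rᗮᗮ := by
    rw [Submodule.mem_orthogonal]
    intro v hv
    rw [real_inner_comm]
    apply horth v
    rw [mem_fixedSpace]
    have h1 : ∀ y, ⟪w y, w v - v⟫ = 0 := by
      intro y
      have h2 := (Submodule.mem_orthogonal R v).mp hv (w y - y) ⟨y, by simp⟩
      rw [inner_sub_left] at h2
      rw [inner_sub_right, hiso]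
      linarith
    have h3 := h1 (w.symm (w v - v))
    rw [LinearEquiv.apply_symm_apply] at h3
    exact sub_eq_zero.mp (inner_self_eq_zero.mp h3)
  rw [Submodule.orthogonal_orthogonal] at hR
  obtain ⟨y, hy⟩ := hR
  exact ⟨y, by simpa using hy⟩

/-- Carter's bound: a Weyl group element is a product of at most as many reflections as the
codimension of its fixed space. -/
lemma exists_list_length_add_finrank_le {Δ : Set V} (hΔ : IsRootSystem Δ) (n : ℕ) :
    ∀ w ∈ weylGroup Δ, finrank ℝ V ≤ finrank ℝ (fixedSpace w) + n →
    ∃ l : List V, (∀ a ∈ l, a ∈ Δ) ∧ (l.map sref).prod = w ∧ l.length ≤ n := by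
  induction n with
  | zero =>
    intro w _ hn
    refine ⟨[], by simp, ?_, by simp⟩
    have htop : fixedSpace w = ⊤ :=
      Submodule.eq_top_of_finrank_eq (le_antisymm (Submodule.finrank_le _) hn)
    ext x
    have : x ∈ fixedSpace w := htop ▸ trivial
    simp [mem_fixedSpace.mp this]
  | succ n ih =>
    intro w hw hn
    by_cases hne : w = 1
    · exact ⟨[], by simp, by simp [hne], by simp⟩
    obtain ⟨α, hα, horth, y, hy⟩ := exists_root_eq_apply_sub hΔ hw hne
    have hα0 : ⟪α, α⟫ ≠ 0 := fun hc => hΔ.ne_zero hα (inner_self_eq_zero.mp hc)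
    have hwy : w y = y + α := by rw [← hy]; abel
    have hsy : sref α (w y) = y := by
      have h1 := inner_apply_of_mem_weylGroup hw y y
      rw [hwy, inner_add_left, inner_add_right, inner_add_right, real_inner_comm α y] at h1
      have h2 : 2 * ⟪α, y⟫ = -⟪α, α⟫ := by linarith
      rw [hwy, map_add, sref_self, sref_apply, h2, neg_div, div_self hα0]
      module
    have hlt : fixedSpace w < fixedSpace (sref α * w) := by
      refine lt_of_le_of_ne (fun z hz => ?_) fun he => ?_
      · rw [mem_fixedSpace, LinearEquiv.mul_apply, mem_fixedSpace.mp hz]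
        exact sref_of_inner_eq_zero (horth z hz)
      · have : y ∈ fixedSpace w := he ▸ mem_fixedSpace.mpr hsy
        rw [mem_fixedSpace.mp this, sub_self] at hy
        exact hΔ.ne_zero hα hy.symm
    have hrank := Submodule.finrank_lt_finrank_of_lt hlt
    obtain ⟨l, hl, hprod, hlen⟩ :=
      ih (sref α * w) (mul_mem (sref_mem_weylGroup hα) hw) (by omega)
    refine ⟨α :: l, ?_, ?_, by simpa using hlen⟩
    · intro a ha
      rcases List.mem_cons.mp ha with rfl | ha
      exacts [hα, hl a ha]
    · rw [List.map_cons, List.prod_cons, hprod, ← mul_assoc, sref_mul_self, one_mul]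

lemma reflLength_le_of_list {Δ : Set V} {l : List V} (hl : ∀ a ∈ l, a ∈ Δ) :
    reflLength Δ (l.map sref).prod ≤ l.length := by
  refine Nat.sInf_le ⟨l.get, fun i => hl _ (List.get_mem l i), ?_⟩
  congr 1
  conv_lhs => rw [← List.ofFn_get l, List.map_ofFn]
  rfl

lemma prod_ofFn_sref_apply_sub_mem_span {d : ℕ} (γ : Fin d → V) (x : V) :
    (List.ofFn fun i => sref (γ i)).prod x - x ∈ Submodule.span ℝ (Set.range γ) := by
  induction d with
  | zero => simp
  | succ d ih =>
    rw [List.ofFn_succ, List.prod_cons, LinearEquiv.mul_apply, sref_apply, sub_right_comm]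
    refine sub_mem ?_ (Submodule.smul_mem _ _ (Submodule.subset_span ⟨0, rfl⟩))
    refine Submodule.span_mono ?_ (ih fun i => γ i.succ)
    rintro _ ⟨i, rfl⟩
    exact ⟨i.succ, rfl⟩

lemma prod_ofFn_sref_apply_of_inner_eq_zero {d : ℕ} (γ : Fin d → V) {x : V}
    (h : ∀ i, ⟪γ i, x⟫ = 0) : (List.ofFn fun i => sref (γ i)).prod x = x := by
  induction d with
  | zero => simp
  | succ d ih =>
    rw [List.ofFn_succ, List.prod_cons, LinearEquiv.mul_apply,
      ih (fun i => γ i.succ) fun i => h i.succ, sref_of_inner_eq_zero (h 0)]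

/-- A vector fixed by a product of reflections in linearly independent vectors is orthogonal to
all of them. -/
lemma inner_eq_zero_of_prod_ofFn_sref_apply {d : ℕ} {γ : Fin d → V}
    (hγ : LinearIndependent ℝ γ) {x : V} (h : (List.ofFn fun i => sref (γ i)).prod x = x) :
    ∀ i, ⟪γ i, x⟫ = 0 := by
  induction d with
  | zero => exact fun i => i.elim0
  | succ d ih =>
    obtain ⟨htail, hnot⟩ := linearIndependent_finSucc.mp hγ
    rw [List.ofFn_succ, List.prod_cons, LinearEquiv.mul_apply] at h
    have h1 : (List.ofFn fun i : Fin d => sref (γ i.succ)).prod x = sref (γ 0) x := by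
      conv_rhs => rw [← h, sref_sref]
    have h2 := prod_ofFn_sref_apply_sub_mem_span (Fin.tail γ) x
    have h0 : ⟪γ 0, x⟫ = 0 := by
      by_contra hc
      have hγ0 : ⟪γ 0, γ 0⟫ ≠ 0 := fun hz =>
        hnot (inner_self_eq_zero.mp hz ▸ Submodule.zero_mem _)
      change (List.ofFn fun i : Fin d => sref (γ i.succ)).prod x - x ∈ _ at h2
      rw [h1, sref_apply, sub_sub_cancel_left, Submodule.neg_mem_iff,
        Submodule.smul_mem_iff _ (div_ne_zero (mul_ne_zero two_ne_zero hc) hγ0)] at h2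
      exact hnot h2
    rw [sref_of_inner_eq_zero h0] at h1
    exact fun i => Fin.cases h0 (ih htail h1) i

lemma pairwise_inner_eq_zero_of_prod_ofFn_sref_apply {d : ℕ} {γ : Fin d → V}
    (hγ : LinearIndependent ℝ γ)
    (h : ∀ i, (List.ofFn fun i => sref (γ i)).prod (γ i) = -γ i) :
    ∀ i j, i ≠ j → ⟪γ i, γ j⟫ = 0 := by
  induction d with
  | zero => exact fun i => i.elim0
  | succ d ih =>
    obtain ⟨htail, -⟩ := linearIndependent_finSucc.mp hγ
    have h1 : ∀ i, (List.ofFn fun i : Fin d => sref (γ i.succ)).prod (γ i)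
        = -sref (γ 0) (γ i) := by
      intro i
      have := h i
      rw [List.ofFn_succ, List.prod_cons, LinearEquiv.mul_apply] at this
      rw [← map_neg, ← this, sref_sref]
    have h0 : ∀ i : Fin d, ⟪γ i.succ, γ 0⟫ = 0 :=
      inner_eq_zero_of_prod_ofFn_sref_apply htail (by
        have := h1 0
        rwa [sref_self, neg_neg] at this)
    have ht := ih htail fun i => by
      have := h1 i.succ
      rwa [sref_of_inner_eq_zero (by rw [real_inner_comm]; exact h0 i)] at this
    intro i j hij
    induction i using Fin.cases with
    | zero =>
      induction j using Fin.cases with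
      | zero => exact absurd rfl hij
      | succ j => rw [real_inner_comm]; exact h0 j
    | succ i =>
      induction j using Fin.cases with
      | zero => exact h0 i
      | succ j => exact ht i j fun he => hij (congrArg _ he)

theorem statement1 {Δ : Set V} (hΔ : IsRootSystem Δ) (u : V ≃ₗ[ℝ] V)
    (hu : u ∈ weylGroup Δ) (huinv : u * u = 1)
    {d : ℕ} (hd : d = reflLength Δ u)
    (γ : Fin d → V) (hγ : ∀ i, γ i ∈ Δ)
    (hprod : u = (List.ofFn fun i => sref (γ i)).prod) :
    ∀ i j, i ≠ j → ⟪γ i, γ j⟫ = 0 := by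
  let R := LinearMap.range (u.toLinearMap - LinearMap.id)
  let S := Submodule.span ℝ (Set.range γ)
  have hrank : finrank ℝ R + finrank ℝ (fixedSpace u) = finrank ℝ V :=
    LinearMap.finrank_range_add_finrank_ker _
  have hdR : d ≤ finrank ℝ R := by
    obtain ⟨l, hl, hlu, hlen⟩ :=
      exists_list_length_add_finrank_le hΔ (finrank ℝ R) u hu (by omega)
    have := reflLength_le_of_list hl
    rw [hlu, ← hd] at this
    exact this.trans hlen
  have hRS : R ≤ S := by
    rintro _ ⟨x, rfl⟩
    have := prod_ofFn_sref_apply_sub_mem_span γ x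
    rw [← hprod] at this
    simpa using this
  have hSd : finrank ℝ S ≤ d := by
    simpa [Set.finrank] using finrank_range_le_card (R := ℝ) γ
  have hRSeq : R = S := Submodule.eq_of_le_of_finrank_le hRS (hSd.trans hdR)
  have hli : LinearIndependent ℝ γ := by
    rw [linearIndependent_iff_card_le_finrank_span, Fintype.card_fin]
    exact hdR.trans (Submodule.finrank_mono hRS)
  refine pairwise_inner_eq_zero_of_prod_ofFn_sref_apply hli fun i => ?_
  rw [← hprod]
  have hi : γ i ∈ R := hRSeq ▸ Submodule.subset_span ⟨i, rfl⟩
  obtain ⟨y, hy⟩ := hi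
  have huu : u (u y) = y := by rw [← LinearEquiv.mul_apply, huinv]; rfl
  have hy' : γ i = u y - y := by simpa using hy.symm
  rw [hy', map_sub, huu, neg_sub]
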